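/- arXiv:0911.4751 — 12 statements merged into one kernel-verified Lean document; each statement's English description precedes it below -/
import Mathlib

section
/- For every x ∈ Δ^7 one has F†(x) ≥ 9; in particular α† = inf_{x ∈ Δ^7} F†(x) ≥ 9. -/
noncomputable def sigD (t : ℝ) : ℝ := (1 - t) / t

def DeltaSeven : Set (Fin 8 → ℝ) := {x | (∀ i, 0 < x i) ∧ ∑ i, x i = 1}

noncomputable def fD (x : Fin 8 → ℝ) : Fin 8 → ℝ :=
  ![sigD (x 3 + x 4 + x 5) * sigD (x 0),
    sigD (x 3 + x 4 + x 5 + x 6 + x 7) * sigD (x 1),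
    sigD (x 0 + x 1 + x 2 + x 6 + x 7) * sigD (x 2),
    sigD (x 0 + x 1 + x 2) * sigD (x 3),
    sigD (x 0 + x 1 + x 2 + x 6 + x 7) * sigD (x 4),
    sigD (x 3 + x 4 + x 5 + x 6 + x 7) * sigD (x 5),
    sigD (x 3 + x 4 + x 5) * sigD (x 6),
    sigD (x 0 + x 1 + x 2) * sigD (x 7)]

noncomputable def FD (x : Fin 8 → ℝ) : ℝ :=
  Finset.univ.sup' Finset.univ_nonempty (fD x)

noncomputable def alphaD : ℝ := sInf (FD '' DeltaSeven)


theorem sigD_key {S y : ℝ} (hS : 0 < S) (hy : 0 < y) (h : sigD S * sigD y < 9) :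
    1 / 2 - S < y := by
  unfold sigD at h
  rw [div_mul_div_comm, div_lt_iff₀ (by positivity)] at h
  by_contra hc
  push Not at hc
  have h1 : y * (1 + 8 * S) ≤ (1 / 2 - S) * (1 + 8 * S) :=
    mul_le_mul_of_nonneg_right hc (by linarith)
  nlinarith [sq_nonneg (4 * S - 1)]

theorem FD_ge (x : Fin 8 → ℝ) (hx : x ∈ DeltaSeven) : 9 ≤ FD x := by
  obtain ⟨hp, hs⟩ := hx
  by_contra hc
  push Not at hc
  have hall : ∀ i, fD x i < 9 := fun i =>
    lt_of_le_of_lt (Finset.le_sup' (fD x) (Finset.mem_univ i)) hc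
  have h6 : sigD (x 3 + x 4 + x 5) * sigD (x 6) < 9 := hall 6
  have h7 : sigD (x 0 + x 1 + x 2) * sigD (x 7) < 9 := hall 7
  have k6 := sigD_key (by linarith [hp 3, hp 4, hp 5]) (hp 6) h6
  have k7 := sigD_key (by linarith [hp 0, hp 1, hp 2]) (hp 7) h7
  simp only [Fin.sum_univ_eight] at hs
  linarith

theorem stmt1 :
    (∀ x ∈ DeltaSeven, 9 ≤ FD x) ∧ 9 ≤ alphaD := by
  refine ⟨FD_ge, ?_⟩
  unfold alphaD
  apply le_csInf
  · refine Set.Nonempty.image _ ⟨fun _ => 1 / 8, ?_, ?_⟩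
    · intro i
      norm_num
    · simp
  · rintro _ ⟨x, hx, rfl⟩
    exact FD_ge x hx
end

section
/- Let x̄ ∈ ℝ^8 be the point with coordinates x̄_i = (√2−1)/2 for i ∈ {1,4,7,8} and x̄_i = (3−2√2)/4 for i ∈ {2,3,5,6}. Then x̄ ∈ Δ^7, f_i(x̄) = 5+3√2 for every i ∈ {1,…,8}, and hence F†(x̄) = 5+3√2 and α† ≤ 5+3√2. -/
noncomputable def xbar : Fin 8 → ℝ :=
  ![(Real.sqrt 2 - 1) / 2, (3 - 2 * Real.sqrt 2) / 4, (3 - 2 * Real.sqrt 2) / 4,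
    (Real.sqrt 2 - 1) / 2, (3 - 2 * Real.sqrt 2) / 4, (3 - 2 * Real.sqrt 2) / 4,
    (Real.sqrt 2 - 1) / 2, (Real.sqrt 2 - 1) / 2]

theorem sig_nonneg_aux {t : ℝ} (h0 : 0 < t) (h1 : t ≤ 1) : 0 ≤ sigD t := by
  unfold sigD
  exact div_nonneg (by linarith) h0.le

theorem fD_zero_nonneg {x : Fin 8 → ℝ} (hx : x ∈ DeltaSeven) : 0 ≤ fD x 0 := by
  obtain ⟨hp, hs⟩ := hx
  simp only [Fin.sum_univ_eight] at hs
  have h0 := hp 0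
  have h1 := hp 1
  have h2 := hp 2
  have h3 := hp 3
  have h4 := hp 4
  have h5 := hp 5
  have h6 := hp 6
  have h7 := hp 7
  show 0 ≤ sigD (x 3 + x 4 + x 5) * sigD (x 0)
  exact mul_nonneg (sig_nonneg_aux (by linarith) (by linarith))
    (sig_nonneg_aux h0 (by linarith))

theorem sig_eq_aux {t v : ℝ} (h0 : t ≠ 0) (h : 1 - t = v * t) : sigD t = v := by
  unfold sigD
  rw [h, mul_div_assoc, div_self h0, mul_one]

theorem stmt2 :
    xbar ∈ DeltaSeven ∧ (∀ i : Fin 8, fD xbar i = 5 + 3 * Real.sqrt 2) ∧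
    FD xbar = 5 + 3 * Real.sqrt 2 ∧ alphaD ≤ 5 + 3 * Real.sqrt 2 := by
  have hsq : Real.sqrt 2 * Real.sqrt 2 = 2 := Real.mul_self_sqrt (by norm_num)
  have hn : 0 ≤ Real.sqrt 2 := Real.sqrt_nonneg 2
  have hlo : 1 < Real.sqrt 2 := by nlinarith
  have hhi : Real.sqrt 2 < 3 / 2 := by nlinarith
  have e0 : xbar 0 = (Real.sqrt 2 - 1) / 2 := rfl
  have e1 : xbar 1 = (3 - 2 * Real.sqrt 2) / 4 := rfl
  have e2 : xbar 2 = (3 - 2 * Real.sqrt 2) / 4 := rfl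
  have e3 : xbar 3 = (Real.sqrt 2 - 1) / 2 := rfl
  have e4 : xbar 4 = (3 - 2 * Real.sqrt 2) / 4 := rfl
  have e5 : xbar 5 = (3 - 2 * Real.sqrt 2) / 4 := rfl
  have e6 : xbar 6 = (Real.sqrt 2 - 1) / 2 := rfl
  have e7 : xbar 7 = (Real.sqrt 2 - 1) / 2 := rfl
  have hmem : xbar ∈ DeltaSeven := by
    constructor
    · intro i
      fin_cases i
      · show 0 < xbar 0; linarith
      · show 0 < xbar 1; linarith
      · show 0 < xbar 2; linarith
      · show 0 < xbar 3; linarith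
      · show 0 < xbar 4; linarith
      · show 0 < xbar 5; linarith
      · show 0 < xbar 6; linarith
      · show 0 < xbar 7; linarith
    · rw [Fin.sum_univ_eight]
      linarith
  have big : sigD ((Real.sqrt 2 - 1) / 2) = 2 * Real.sqrt 2 + 1 :=
    sig_eq_aux (by linarith) (by linarith)
  have small : sigD ((3 - 2 * Real.sqrt 2) / 4) = 11 + 8 * Real.sqrt 2 :=
    sig_eq_aux (by linarith) (by linarith)
  have three : ∀ t, t = (2 - Real.sqrt 2) / 2 → sigD t = Real.sqrt 2 + 1 := by
    rintro t rfl
    exact sig_eq_aux (by linarith) (by linarith)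
  have five : ∀ t, t = Real.sqrt 2 / 2 → sigD t = Real.sqrt 2 - 1 := by
    rintro t rfl
    exact sig_eq_aux (by linarith) (by linarith)
  have hA : sigD (xbar 3 + xbar 4 + xbar 5) = Real.sqrt 2 + 1 := three _ (by linarith)
  have hB : sigD (xbar 0 + xbar 1 + xbar 2) = Real.sqrt 2 + 1 := three _ (by linarith)
  have hC : sigD (xbar 3 + xbar 4 + xbar 5 + xbar 6 + xbar 7) = Real.sqrt 2 - 1 :=
    five _ (by linarith)
  have hD : sigD (xbar 0 + xbar 1 + xbar 2 + xbar 6 + xbar 7) = Real.sqrt 2 - 1 :=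
    five _ (by linarith)
  have p1 : (Real.sqrt 2 + 1) * (2 * Real.sqrt 2 + 1) = 5 + 3 * Real.sqrt 2 := by linarith
  have p2 : (Real.sqrt 2 - 1) * (11 + 8 * Real.sqrt 2) = 5 + 3 * Real.sqrt 2 := by linarith
  have hf : ∀ i : Fin 8, fD xbar i = 5 + 3 * Real.sqrt 2 := by
    intro i
    fin_cases i
    · show sigD (xbar 3 + xbar 4 + xbar 5) * sigD (xbar 0) = _
      rw [hA, e0, big, p1]
    · show sigD (xbar 3 + xbar 4 + xbar 5 + xbar 6 + xbar 7) * sigD (xbar 1) = _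
      rw [hC, e1, small, p2]
    · show sigD (xbar 0 + xbar 1 + xbar 2 + xbar 6 + xbar 7) * sigD (xbar 2) = _
      rw [hD, e2, small, p2]
    · show sigD (xbar 0 + xbar 1 + xbar 2) * sigD (xbar 3) = _
      rw [hB, e3, big, p1]
    · show sigD (xbar 0 + xbar 1 + xbar 2 + xbar 6 + xbar 7) * sigD (xbar 4) = _
      rw [hD, e4, small, p2]
    · show sigD (xbar 3 + xbar 4 + xbar 5 + xbar 6 + xbar 7) * sigD (xbar 5) = _
      rw [hC, e5, small, p2]
    · show sigD (xbar 3 + xbar 4 + xbar 5) * sigD (xbar 6) = _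
      rw [hA, e6, big, p1]
    · show sigD (xbar 0 + xbar 1 + xbar 2) * sigD (xbar 7) = _
      rw [hB, e7, big, p1]
  have hF : FD xbar = 5 + 3 * Real.sqrt 2 := by
    unfold FD
    apply le_antisymm
    · exact Finset.sup'_le _ _ (fun i _ => (hf i).le)
    · rw [← hf 0]
      exact Finset.le_sup' (fD xbar) (Finset.mem_univ 0)
  refine ⟨hmem, hf, hF, ?_⟩
  rw [← hF]
  refine csInf_le ⟨0, ?_⟩ ⟨xbar, hmem, rfl⟩
  rintro _ ⟨x, hx, rfl⟩
  exact (fD_zero_nonneg hx).trans (Finset.le_sup' (fD x) (Finset.mem_univ 0))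
end

section
/- The function F† attains its infimum on Δ^7: there exists a point x* ∈ Δ^7 such that F†(x*) = α† = inf_{x ∈ Δ^7} F†(x); in particular inf_{x ∈ Δ^7} F†(x) = min_{x ∈ Δ^7} F†(x). -/
lemma L1 {x c s M : ℝ} (hx : 0 < x) (hx1 : x < 1) (hc : 0 < c) (hM : 0 < M) (hs : c ≤ s)
    (h : s * sigD x ≤ M) : c / (M + c) ≤ x := by
  have h0 : 0 ≤ sigD x := div_nonneg (by linarith) hx.le
  have h1 : c * sigD x ≤ M := (mul_le_mul_of_nonneg_right hs h0).trans h
  unfold sigD at h1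
  rw [← mul_div_assoc, div_le_iff₀ hx] at h1
  rw [div_le_iff₀ (by positivity)]
  linarith

lemma L2 {t : ℝ} (ht : 0 < t) (ht1 : t < 1) : 1 - t ≤ sigD t := by
  unfold sigD
  rw [le_div_iff₀ ht]
  nlinarith

lemma L3 {x y s M : ℝ} (hx : 0 < x) (hy : 0 < y) (hxy : x + y < 1) (hs : 0 ≤ s)
    (h1 : s * sigD x ≤ M) (h2 : s * sigD y ≤ M) : s ≤ M := by
  have key : ∀ z : ℝ, 0 < z → z ≤ 1 / 2 → s * sigD z ≤ M → s ≤ M := by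
    intro z hz hz2 h
    have : 1 ≤ sigD z := by
      unfold sigD
      rw [le_div_iff₀ hz]
      linarith
    nlinarith
  rcases le_total x (1 / 2) with h | h
  · exact key x hx h h1
  · exact key y hy (by linarith) h2

lemma L4 {t M : ℝ} (ht : 0 < t) (ht1 : t < 1) (hM : 0 < M) (h : sigD t ≤ M) :
    1 / (M + 1) ≤ t :=
  L1 ht ht1 one_pos hM le_rfl (by simpa using h)

lemma bound_below {M : ℝ} (hM : 0 < M) : ∃ d : ℝ, 0 < d ∧
    ∀ x ∈ DeltaSeven, FD x ≤ M → ∀ i, d ≤ x i := by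
  obtain ⟨c, hc⟩ : ∃ c : ℝ, c = 1 / (M + 1) := ⟨_, rfl⟩
  have hc0 : 0 < c := by rw [hc]; positivity
  obtain ⟨e, he⟩ : ∃ e : ℝ, e = c / (M + c) := ⟨_, rfl⟩
  have he0 : 0 < e := by rw [he]; positivity
  obtain ⟨d, hd⟩ : ∃ d : ℝ, d = e / (M + e) := ⟨_, rfl⟩
  have hd0 : 0 < d := by rw [hd]; positivity
  refine ⟨min e d, lt_min he0 hd0, ?_⟩
  rintro x ⟨hpos, hsum⟩ hF
  have hf : ∀ i, fD x i ≤ M := fun i =>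
    (Finset.le_sup' (fD x) (Finset.mem_univ i)).trans hF
  have f0 : sigD (x 3 + x 4 + x 5) * sigD (x 0) ≤ M := hf 0
  have f1 : sigD (x 3 + x 4 + x 5 + x 6 + x 7) * sigD (x 1) ≤ M := hf 1
  have f2 : sigD (x 0 + x 1 + x 2 + x 6 + x 7) * sigD (x 2) ≤ M := hf 2
  have f3 : sigD (x 0 + x 1 + x 2) * sigD (x 3) ≤ M := hf 3
  have f4 : sigD (x 0 + x 1 + x 2 + x 6 + x 7) * sigD (x 4) ≤ M := hf 4
  have f5 : sigD (x 3 + x 4 + x 5 + x 6 + x 7) * sigD (x 5) ≤ M := hf 5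
  have f6 : sigD (x 3 + x 4 + x 5) * sigD (x 6) ≤ M := hf 6
  have f7 : sigD (x 0 + x 1 + x 2) * sigD (x 7) ≤ M := hf 7
  rw [Fin.sum_univ_eight] at hsum
  have p0 := hpos 0
  have p1 := hpos 1
  have p2 := hpos 2
  have p3 := hpos 3
  have p4 := hpos 4
  have p5 := hpos 5
  have p6 := hpos 6
  have p7 := hpos 7
  have sA := L2 (t := x 0 + x 1 + x 2) (by linarith) (by linarith)
  have sB := L2 (t := x 3 + x 4 + x 5) (by linarith) (by linarith)
  have sT := L2 (t := x 3 + x 4 + x 5 + x 6 + x 7) (by linarith) (by linarith)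
  have sU := L2 (t := x 0 + x 1 + x 2 + x 6 + x 7) (by linarith) (by linarith)
  have T := L4 (by linarith) (by linarith) hM (L3 p1 p5 (by linarith) (by linarith) f1 f5)
  have U := L4 (by linarith) (by linarith) hM (L3 p2 p4 (by linarith) (by linarith) f2 f4)
  rw [← hc] at T U
  have b0 := L1 p0 (by linarith) hc0 hM (by linarith) f0
  have b3 := L1 p3 (by linarith) hc0 hM (by linarith) f3
  have b6 := L1 p6 (by linarith) hc0 hM (by linarith) f6
  have b7 := L1 p7 (by linarith) hc0 hM (by linarith) f7
  rw [← he] at b0 b3 b6 b7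
  have b1 := L1 p1 (by linarith) he0 hM (by linarith) f1
  have b2 := L1 p2 (by linarith) he0 hM (by linarith) f2
  have b4 := L1 p4 (by linarith) he0 hM (by linarith) f4
  have b5 := L1 p5 (by linarith) he0 hM (by linarith) f5
  rw [← hd] at b1 b2 b4 b5
  intro i
  fin_cases i
  · exact (min_le_left _ _).trans b0
  · exact (min_le_right _ _).trans b1
  · exact (min_le_right _ _).trans b2
  · exact (min_le_left _ _).trans b3
  · exact (min_le_right _ _).trans b4
  · exact (min_le_right _ _).trans b5
  · exact (min_le_left _ _).trans b6
  · exact (min_le_left _ _).trans b7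

lemma sig_cont {s : Set (Fin 8 → ℝ)} {g : (Fin 8 → ℝ) → ℝ} (hg : Continuous g)
    (h : ∀ x ∈ s, 0 < g x) : ContinuousOn (fun x => sigD (g x)) s := by
  unfold sigD
  exact ((continuous_const.sub hg).continuousOn).div hg.continuousOn fun x hx => (h x hx).ne'

lemma FD_cont : ContinuousOn FD DeltaSeven := by
  unfold FD
  refine ContinuousOn.finset_sup'_apply Finset.univ_nonempty ?_
  intro i _
  fin_cases i <;>
  · refine ContinuousOn.mul (sig_cont (by fun_prop) ?_) (sig_cont (by fun_prop) ?_) <;>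
    · rintro x ⟨hpos, -⟩
      have p0 := hpos 0
      have p1 := hpos 1
      have p2 := hpos 2
      have p3 := hpos 3
      have p4 := hpos 4
      have p5 := hpos 5
      have p6 := hpos 6
      have p7 := hpos 7
      first | assumption | positivity

theorem stmt3 :
    ∃ xs ∈ DeltaSeven, FD xs = alphaD ∧ ∀ x ∈ DeltaSeven, FD xs ≤ FD x := by
  let u : Fin 8 → ℝ := fun _ => 1 / 8
  have hu : u ∈ DeltaSeven := ⟨fun i => by simp [u], by simp [u]⟩
  have hM : 0 < |FD u| + 1 := by positivity
  have huM : FD u ≤ |FD u| + 1 := by linarith [le_abs_self (FD u)]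
  obtain ⟨d, hd, hb⟩ := bound_below hM
  let K : Set (Fin 8 → ℝ) := Set.Icc (fun _ => d) (fun _ => 1) ∩ {x | ∑ i, x i = 1}
  have hK : IsCompact K :=
    isCompact_Icc.inter_right (isClosed_eq (by fun_prop) continuous_const)
  have hKD : K ⊆ DeltaSeven := fun x hx => ⟨fun i => hd.trans_le (hx.1.1 i), hx.2⟩
  have hin : ∀ x ∈ DeltaSeven, FD x ≤ |FD u| + 1 → x ∈ K := by
    intro x hx h
    refine ⟨⟨fun i => hb x hx h i, fun i => ?_⟩, hx.2⟩
    have := Finset.single_le_sum (f := x) (fun j _ => (hx.1 j).le) (Finset.mem_univ i)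
    exact this.trans hx.2.le
  obtain ⟨xs, hxs, hmin⟩ := hK.exists_isMinOn ⟨u, hin u hu huM⟩ (FD_cont.mono hKD)
  have hall : ∀ x ∈ DeltaSeven, FD xs ≤ FD x := by
    intro x hx
    rcases le_total (FD x) (|FD u| + 1) with h | h
    · exact hmin (hin x hx h)
    · exact (show FD xs ≤ FD u from hmin (hin u hu huM)).trans (huM.trans h)
  refine ⟨xs, hKD hxs, ?_, hall⟩
  have hl : IsLeast (FD '' DeltaSeven) (FD xs) :=
    ⟨⟨xs, hKD hxs, rfl⟩, by rintro _ ⟨x, hx, rfl⟩; exact hall x hx⟩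
  exact hl.csInf_eq.symm
end

section
/- No minimizing sequence of F† accumulates at the boundary of the simplex: if (x_n) is a sequence in Δ^7 with F†(x_n) → α†, then (x_n) has no limit point b = (b_1,…,b_8) in the closed simplex {b ∈ ℝ^8 : b_i ≥ 0, b_1+⋯+b_8 = 1} with b_i = 0 for some i ∈ {1,…,8}. -/
theorem sigD_mul_le {s t M : ℝ} (hs : 0 < s) (ht : 0 < t) (h : sigD s * sigD t ≤ M) :
    (1 - s) * (1 - t) ≤ M * (s * t) := by
  unfold sigD at h
  rw [div_mul_div_comm, div_le_iff₀ (mul_pos hs ht)] at h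
  exact h

/-- If `FD` is bounded by `M`, polynomial inequalities hold which pass to limits. -/
def PolyBound (M : ℝ) : Set (Fin 8 → ℝ) := {x |
  (1 - (x 3 + x 4 + x 5)) * (1 - x 0) ≤ M * ((x 3 + x 4 + x 5) * x 0) ∧
  (1 - (x 3 + x 4 + x 5 + x 6 + x 7)) * (1 - x 1) ≤ M * ((x 3 + x 4 + x 5 + x 6 + x 7) * x 1) ∧
  (1 - (x 0 + x 1 + x 2 + x 6 + x 7)) * (1 - x 2) ≤ M * ((x 0 + x 1 + x 2 + x 6 + x 7) * x 2) ∧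
  (1 - (x 0 + x 1 + x 2)) * (1 - x 3) ≤ M * ((x 0 + x 1 + x 2) * x 3) ∧
  (1 - (x 0 + x 1 + x 2 + x 6 + x 7)) * (1 - x 4) ≤ M * ((x 0 + x 1 + x 2 + x 6 + x 7) * x 4) ∧
  (1 - (x 3 + x 4 + x 5 + x 6 + x 7)) * (1 - x 5) ≤ M * ((x 3 + x 4 + x 5 + x 6 + x 7) * x 5) ∧
  (1 - (x 3 + x 4 + x 5)) * (1 - x 6) ≤ M * ((x 3 + x 4 + x 5) * x 6) ∧
  (1 - (x 0 + x 1 + x 2)) * (1 - x 7) ≤ M * ((x 0 + x 1 + x 2) * x 7)}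

theorem isClosed_polyBound (M : ℝ) : IsClosed (PolyBound M) := by
  unfold PolyBound
  repeat' apply IsClosed.and
  all_goals exact isClosed_le (by fun_prop) (by fun_prop)

theorem mem_polyBound {M : ℝ} {x : Fin 8 → ℝ} (hx : x ∈ DeltaSeven) (h : FD x ≤ M) :
    x ∈ PolyBound M := by
  have hp := hx.1
  have hf : ∀ i, fD x i ≤ M := fun i =>
    (Finset.le_sup' (fD x) (Finset.mem_univ i)).trans h
  have p0 := hp 0
  have p1 := hp 1
  have p2 := hp 2
  have p3 := hp 3
  have p4 := hp 4
  have p5 := hp 5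
  have p6 := hp 6
  have p7 := hp 7
  exact ⟨sigD_mul_le (by positivity) p0 (hf 0), sigD_mul_le (by positivity) p1 (hf 1),
    sigD_mul_le (by positivity) p2 (hf 2), sigD_mul_le (by positivity) p3 (hf 3),
    sigD_mul_le (by positivity) p4 (hf 4), sigD_mul_le (by positivity) p5 (hf 5),
    sigD_mul_le (by positivity) p6 (hf 6), sigD_mul_le (by positivity) p7 (hf 7)⟩

theorem polyBound_pos {M : ℝ} {b : Fin 8 → ℝ} (h0 : ∀ i, 0 ≤ b i) (hs : ∑ i, b i = 1)
    (hb : b ∈ PolyBound M) (i : Fin 8) : b i ≠ 0 := by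
  obtain ⟨e0, e1, e2, e3, e4, e5, e6, e7⟩ := hb
  simp only [Fin.sum_univ_eight] at hs
  have p0 := h0 0
  have p1 := h0 1
  have p2 := h0 2
  have p3 := h0 3
  have p4 := h0 4
  have p5 := h0 5
  have p6 := h0 6
  have p7 := h0 7
  have hA : 0 < b 0 + b 1 + b 2 := by
    by_contra hc
    have hz : b 0 + b 1 + b 2 = 0 := by linarith
    rw [hz] at e3 e7
    linarith
  have hB : 0 < b 3 + b 4 + b 5 := by
    by_contra hc
    have hz : b 3 + b 4 + b 5 = 0 := by linarith
    rw [hz] at e0 e6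
    linarith
  intro hi
  fin_cases i <;> simp only [Fin.zero_eta, Fin.mk_one, Fin.reduceFinMk] at hi
  · rw [hi] at e0; linarith
  · rw [hi] at e1; linarith
  · rw [hi] at e2; linarith
  · rw [hi] at e3; linarith
  · rw [hi] at e4; linarith
  · rw [hi] at e5; linarith
  · rw [hi] at e6; linarith
  · rw [hi] at e7; linarith

theorem stmt4 (x : ℕ → (Fin 8 → ℝ)) (hx : ∀ n, x n ∈ DeltaSeven)
    (hconv : Filter.Tendsto (fun n => FD (x n)) Filter.atTop (nhds alphaD)) :
    ¬ ∃ b : Fin 8 → ℝ, (∀ i, 0 ≤ b i) ∧ (∑ i, b i = 1) ∧ (∃ i, b i = 0) ∧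
      MapClusterPt b Filter.atTop x := by
  rintro ⟨b, h0, hs, ⟨i, hi⟩, hc⟩
  have hev : ∀ᶠ n in Filter.atTop, x n ∈ PolyBound (alphaD + 1) := by
    filter_upwards [hconv.eventually (gt_mem_nhds (lt_add_one alphaD))] with n hn
    exact mem_polyBound (hx n) hn.le
  have hb : b ∈ PolyBound (alphaD + 1) := by
    rw [← (isClosed_polyBound (alphaD + 1)).closure_eq, mem_closure_iff_clusterPt]
    exact ClusterPt.mono hc (Filter.le_principal_iff.2 hev)
  exact polyBound_pos h0 hs hb i hi
end

section
/- Let Δ^{7,8} = {(x_1,…,x_7) ∈ ℝ^7 : x_i > 0 for all i and x_1+⋯+x_7 < 1}, and for each i ∈ {1,…,8} define f_i^8 : Δ^{7,8} → ℝ by f_i^8(x_1,…,x_7) = f_i(x_1,…,x_7, 1−(x_1+⋯+x_7)). Then none of the functions f_1^8,…,f_8^8 has a local extremum (local minimum or local maximum) at any point of Δ^{7,8}. -/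
def Delta78 : Set (Fin 7 → ℝ) := {y | (∀ i, 0 < y i) ∧ ∑ i, y i < 1}

noncomputable def pEight (y : Fin 7 → ℝ) : Fin 8 → ℝ := Fin.snoc y (1 - ∑ i, y i)

noncomputable def fD8 (i : Fin 8) (y : Fin 7 → ℝ) : ℝ := fD (pEight y) i

lemma isOpen_Delta78 : IsOpen Delta78 := by
  have h : Delta78 = (⋂ i : Fin 7, {y | 0 < y i}) ∩ {y | ∑ i, y i < 1} := by
    ext y; simp [Delta78]
  rw [h]
  refine (isOpen_iInter_of_finite fun i => ?_).inter ?_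
  · exact isOpen_lt continuous_const (continuous_apply i)
  · exact isOpen_lt (by fun_prop) continuous_const

lemma sigD_pos {t : ℝ} (h0 : 0 < t) (h1 : t < 1) : 0 < sigD t :=
  div_pos (by linarith) h0

lemma no_extr (g : (Fin 7 → ℝ) → ℝ) (y : Fin 7 → ℝ) (hy : y ∈ Delta78) (v : Fin 7 → ℝ)
    (b a : ℝ) (hb0 : 0 < b) (hb1 : b < 1) (ha : 0 < a)
    (h : ∀ t : ℝ, g (y + t • v) = sigD b * sigD (a + t)) :
    ¬ IsLocalMinOn g Delta78 y ∧ ¬ IsLocalMaxOn g Delta78 y := by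
  have hn : Delta78 ∈ nhds y := isOpen_Delta78.mem_nhds hy
  have hc := sigD_pos hb0 hb1
  have hcont : ContinuousAt (fun t : ℝ => y + t • v) 0 := by fun_prop
  have hfun : g ∘ (fun t : ℝ => y + t • v) = fun t => sigD b * sigD (a + t) := funext h
  have hd : HasDerivAt (fun t => sigD b * sigD (a + t)) (sigD b * (-1 / a ^ 2)) 0 := by
    have h1 : HasDerivAt (fun t : ℝ => a + t) 1 0 := (hasDerivAt_id (0 : ℝ)).const_add a
    have h2 := ((h1.const_sub 1).div h1 (by simpa using ha.ne')).const_mul (sigD b)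
    refine HasDerivAt.congr_deriv (f := fun t => sigD b * sigD (a + t)) h2 ?_
    rw [add_zero]
    congr 2
    ring
  have hne : sigD b * (-1 / a ^ 2) ≠ 0 :=
    mul_ne_zero hc.ne' (div_ne_zero (by norm_num) (by positivity))
  constructor
  · intro hm
    have hm' : IsLocalMin g ((fun t : ℝ => y + t • v) 0) := by simpa using hm.isLocalMin hn
    have h3 : IsLocalMin (g ∘ (fun t : ℝ => y + t • v)) 0 := hcont.eventually hm'
    rw [hfun] at h3
    exact hne (h3.hasDerivAt_eq_zero hd)
  · intro hm
    have hm' : IsLocalMax g ((fun t : ℝ => y + t • v) 0) := by simpa using hm.isLocalMax hn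
    have h3 : IsLocalMax (g ∘ (fun t : ℝ => y + t • v)) 0 := hcont.eventually hm'
    rw [hfun] at h3
    exact hne (h3.hasDerivAt_eq_zero hd)

lemma pEight_eq (y : Fin 7 → ℝ) : pEight y =
    ![y 0, y 1, y 2, y 3, y 4, y 5, y 6, 1 - (y 0 + y 1 + y 2 + y 3 + y 4 + y 5 + y 6)] := by
  funext i
  unfold pEight
  rw [Fin.sum_univ_seven]
  fin_cases i <;> rfl

theorem stmt5 : ∀ i : Fin 8, ∀ y ∈ Delta78,
    ¬ IsLocalMinOn (fD8 i) Delta78 y ∧ ¬ IsLocalMaxOn (fD8 i) Delta78 y := by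
  intro i y hy
  obtain ⟨hp, hs⟩ := id hy
  rw [Fin.sum_univ_seven] at hs
  have p0 := hp 0
  have p1 := hp 1
  have p2 := hp 2
  have p3 := hp 3
  have p4 := hp 4
  have p5 := hp 5
  have p6 := hp 6
  fin_cases i
  · refine no_extr _ y hy ![1, -1, 0, 0, 0, 0, 0] (y 3 + y 4 + y 5) (y 0)
      (by linarith) (by linarith) (by linarith) fun t => ?_
    simp [fD8, fD, pEight_eq, -Matrix.add_cons]
  · refine no_extr _ y hy ![-1, 1, 0, 0, 0, 0, 0] (1 - (y 0 + y 1 + y 2)) (y 1)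
      (by linarith) (by linarith) (by linarith) fun t => ?_
    simp [fD8, fD, pEight_eq, -Matrix.add_cons]
    left; congr 1; ring
  · refine no_extr _ y hy ![-1, 0, 1, 0, 0, 0, 0] (1 - (y 3 + y 4 + y 5)) (y 2)
      (by linarith) (by linarith) (by linarith) fun t => ?_
    simp [fD8, fD, pEight_eq, -Matrix.add_cons]
    left; congr 1; ring
  · refine no_extr _ y hy ![0, 0, 0, 1, -1, 0, 0] (y 0 + y 1 + y 2) (y 3)
      (by linarith) (by linarith) (by linarith) fun t => ?_
    simp [fD8, fD, pEight_eq, -Matrix.add_cons]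
  · refine no_extr _ y hy ![0, 0, 0, -1, 1, 0, 0] (1 - (y 3 + y 4 + y 5)) (y 4)
      (by linarith) (by linarith) (by linarith) fun t => ?_
    simp [fD8, fD, pEight_eq, -Matrix.add_cons]
    left; congr 1; ring
  · refine no_extr _ y hy ![0, 0, 0, -1, 0, 1, 0] (1 - (y 0 + y 1 + y 2)) (y 5)
      (by linarith) (by linarith) (by linarith) fun t => ?_
    simp [fD8, fD, pEight_eq, -Matrix.add_cons]
    left; congr 1; ring
  · refine no_extr _ y hy ![-1, 0, 0, 0, 0, 0, 1] (y 3 + y 4 + y 5) (y 6)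
      (by linarith) (by linarith) (by linarith) fun t => ?_
    simp [fD8, fD, pEight_eq, -Matrix.add_cons]
  · refine no_extr _ y hy ![0, 0, 0, -1, 0, 0, 0] (y 0 + y 1 + y 2)
      (1 - (y 0 + y 1 + y 2 + y 3 + y 4 + y 5 + y 6))
      (by linarith) (by linarith) (by linarith) fun t => ?_
    simp [fD8, fD, pEight_eq, -Matrix.add_cons]
    left; congr 1; ring
end

section
/- If y ∈ Δ^7 satisfies F†(y) = α† = inf_{x ∈ Δ^7} F†(x), then f_j(y) = f_k(y) for all j, k ∈ {1,…,8}; that is, every minimizer of F† lies in the set Δ_7 = {y ∈ Δ^7 : f_j(y) = f_k(y) for all j, k}. -/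
noncomputable def phiD (α t : ℝ) : ℝ := (1 - t) / (1 - t + α * t)

lemma phiD_den {α t : ℝ} (hα : 0 < α) (h0 : 0 < t) (h1 : t < 1) : 0 < 1 - t + α * t := by
  have := mul_pos hα h0
  linarith

lemma phiD_pos {α t : ℝ} (hα : 0 < α) (h0 : 0 < t) (h1 : t < 1) : 0 < phiD α t :=
  div_pos (by linarith) (phiD_den hα h0 h1)

lemma sig_le_iff {α t x : ℝ} (hα : 0 < α) (h0 : 0 < t) (h1 : t < 1) (hx : 0 < x) :
    sigD t * sigD x ≤ α ↔ phiD α t ≤ x := by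
  unfold sigD phiD
  rw [div_mul_div_comm, div_le_iff₀ (mul_pos h0 hx), div_le_iff₀ (phiD_den hα h0 h1)]
  constructor <;> intro h <;> linarith

lemma sig_lt_iff {α t x : ℝ} (hα : 0 < α) (h0 : 0 < t) (h1 : t < 1) (hx : 0 < x) :
    sigD t * sigD x < α ↔ phiD α t < x := by
  unfold sigD phiD
  rw [div_mul_div_comm, div_lt_iff₀ (mul_pos h0 hx), div_lt_iff₀ (phiD_den hα h0 h1)]
  constructor <;> intro h <;> linarith

lemma phiD_diff {α t u : ℝ} (hα : 0 < α) (h0 : 0 < t) (h1 : t < 1) (k0 : 0 < u) (k1 : u < 1) :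
    phiD α t - phiD α u = (u - t) * (α / ((1 - t + α * t) * (1 - u + α * u))) := by
  have e1 := (phiD_den hα h0 h1).ne'
  have e2 := (phiD_den hα k0 k1).ne'
  unfold phiD
  rw [div_sub_div _ _ e1 e2, mul_div_assoc']
  congr 1
  ring

lemma phiD_mid {α t u : ℝ} (hα : 1 < α) (h0 : 0 < t) (h1 : t < 1) (k0 : 0 < u) (k1 : u < 1)
    (hne : t ≠ u) : 2 * phiD α ((t + u) / 2) < phiD α t + phiD α u := by
  have hα0 : 0 < α := by linarith
  have m0 : 0 < (t + u) / 2 := by linarith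
  have m1 : (t + u) / 2 < 1 := by linarith
  have e1 := phiD_den hα0 h0 h1
  have e2 := phiD_den hα0 k0 k1
  have e3 := phiD_den hα0 m0 m1
  have d1 := phiD_diff hα0 h0 h1 m0 m1
  have d2 := phiD_diff hα0 m0 m1 k0 k1
  have hsq : 0 < (u - t) ^ 2 := by
    have : u - t ≠ 0 := sub_ne_zero.mpr hne.symm
    positivity
  have key : ((t + u) / 2 - t) * (α / ((1 - t + α * t) * (1 - (t + u) / 2 + α * ((t + u) / 2))))
      - (u - (t + u) / 2) * (α / ((1 - (t + u) / 2 + α * ((t + u) / 2)) * (1 - u + α * u)))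
      = (u - t) ^ 2 * (α * (α - 1)) / (2 * (1 - t + α * t) *
        (1 - (t + u) / 2 + α * ((t + u) / 2)) * (1 - u + α * u)) := by
    generalize hE : 1 - (t + u) / 2 + α * ((t + u) / 2) = E at *
    generalize hE1 : 1 - t + α * t = E1 at *
    generalize hE2 : 1 - u + α * u = E2 at *
    have : (u - t) * (α - 1) = E2 - E1 := by rw [← hE1, ← hE2]; ring
    have h3 : (u - t) ^ 2 * (α * (α - 1)) = (u - t) * α * (E2 - E1) := by rw [← this]; ring
    rw [h3]
    field_simp
    ring
  have : 0 < (u - t) ^ 2 * (α * (α - 1)) / (2 * (1 - t + α * t) *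
        (1 - (t + u) / 2 + α * ((t + u) / 2)) * (1 - u + α * u)) := by
    have : 0 < α - 1 := by linarith
    positivity
  linarith

lemma phiD_cont {α s : ℝ} (hα : 0 < α) (h0 : 0 < s) (h1 : s < 1) :
    ContinuousAt (phiD α) s := by
  unfold phiD
  have := (phiD_den hα h0 h1).ne'
  fun_prop (disch := assumption)

open Filter Topology in
/-- The symmetric case. -/
lemma core_sym {α s : ℝ} (hα : 1 < α) (h0 : 0 < s) (h1 : s < 1 / 2)
    (hP : phiD α s + 2 * phiD α (1 - s) ≤ s) (hQ : 2 * phiD α s ≤ 1 - 2 * s)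
    (hst : phiD α s + 2 * phiD α (1 - s) < s ∨ 2 * phiD α s < 1 - 2 * s) :
    ∃ r, 0 < r ∧ r < 1 / 2 ∧ phiD α r + 2 * phiD α (1 - r) < r ∧ 2 * phiD α r < 1 - 2 * r := by
  have hα0 : 0 < α := by linarith
  have e1 := phiD_den hα0 h0 (by linarith)
  have e2 := phiD_den hα0 (t := 1 - s) (by linarith) (by linarith)
  have c1 := phiD_cont hα0 h0 (by linarith)
  have c2 : ContinuousAt (fun r => phiD α (1 - r)) s := by
    have := phiD_cont hα0 (s := 1 - s) (by linarith) (by linarith)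
    exact ContinuousAt.comp (f := fun r : ℝ => 1 - r) (g := phiD α) this (by fun_prop)
  have cid : ContinuousAt (fun r : ℝ => r) s := continuousAt_id
  have ev0 : ∀ᶠ r in 𝓝 s, 0 < r := lt_mem_nhds h0
  have ev1 : ∀ᶠ r in 𝓝 s, r < 1 / 2 := gt_mem_nhds h1
  rcases hst with hst | hst
  · -- move left
    have hs : 1 - s < s * (1 - s + α * s) := by
      have h2 : phiD α s < s := by
        have := phiD_pos hα0 (t := 1 - s) (by linarith) (by linarith)
        linarith
      unfold phiD at h2
      rwa [div_lt_iff₀ e1] at h2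
    have hE : α < (1 - s + α * s) * (1 - s + α * s) := by
      have : 0 < (α - 1) * (α * s ^ 2 - (1 - s) ^ 2) :=
        mul_pos (by linarith) (by nlinarith)
      nlinarith
    have hc : ContinuousAt (fun r => α / ((1 - s + α * s) * (1 - r + α * r))) s := by
      have := (mul_pos e1 e1).ne'
      fun_prop (disch := assumption)
    have evE : ∀ᶠ r in 𝓝 s, α / ((1 - s + α * s) * (1 - r + α * r)) < 1 := by
      apply hc.eventually_lt continuousAt_const
      rw [div_lt_one (mul_pos e1 e1)]
      exact hE
    have evP : ∀ᶠ r in 𝓝 s, phiD α r + 2 * phiD α (1 - r) < r :=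
      (c1.add (c2.const_mul 2)).eventually_lt cid hst
    have evL : ∀ᶠ r in 𝓝[<] s, r < s := self_mem_nhdsWithin
    obtain ⟨r, hr, r0, r1, rE, rP⟩ := (evL.and (nhdsWithin_le_nhds
      (ev0.and (ev1.and (evE.and evP))))).exists
    refine ⟨r, r0, r1, rP, ?_⟩
    have d := phiD_diff hα0 h0 (by linarith) r0 (by linarith)
    have := mul_lt_mul_of_pos_left rE (sub_pos.mpr hr)
    linarith
  · -- move right
    have hc : ContinuousAt (fun r => 1 + α / ((1 - s + α * s) * (1 - r + α * r))
        - 2 * (α / ((1 - (1 - s) + α * (1 - s)) * (1 - (1 - r) + α * (1 - r))))) s := by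
      have := (mul_pos e1 e1).ne'
      have := (mul_pos e2 e2).ne'
      fun_prop (disch := assumption)
    have hpos : 0 < 1 + α / ((1 - s + α * s) * (1 - s + α * s))
        - 2 * (α / ((1 - (1 - s) + α * (1 - s)) * (1 - (1 - s) + α * (1 - s)))) := by
      have hD : α < (1 - (1 - s) + α * (1 - s)) * (1 - (1 - s) + α * (1 - s)) := by
        have : 0 < (α - 1) * (α * (1 - s) ^ 2 - s ^ 2) :=
          mul_pos (by linarith) (by nlinarith)
        nlinarith
      have hDE : 1 - s + α * s ≤ 1 - (1 - s) + α * (1 - s) := by nlinarith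
      have a1 : α / ((1 - (1 - s) + α * (1 - s)) * (1 - (1 - s) + α * (1 - s))) < 1 := by
        rw [div_lt_one (mul_pos e2 e2)]; exact hD
      have a2 : α / ((1 - (1 - s) + α * (1 - s)) * (1 - (1 - s) + α * (1 - s)))
          ≤ α / ((1 - s + α * s) * (1 - s + α * s)) :=
        div_le_div_of_nonneg_left hα0.le (mul_pos e1 e1)
          (mul_le_mul hDE hDE e1.le e2.le)
      linarith
    have evE := continuousAt_const.eventually_lt hc hpos
    have evQ : ∀ᶠ r in 𝓝 s, 2 * phiD α r < 1 - 2 * r :=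
      (c1.const_mul 2).eventually_lt (by fun_prop) hst
    have evL : ∀ᶠ r in 𝓝[>] s, s < r := self_mem_nhdsWithin
    obtain ⟨r, hr, r0, r1, rE, rQ⟩ := (evL.and (nhdsWithin_le_nhds
      (ev0.and (ev1.and (evE.and evQ))))).exists
    refine ⟨r, r0, r1, ?_, rQ⟩
    have d := phiD_diff hα0 h0 (by linarith) r0 (by linarith)
    have d' := phiD_diff hα0 (t := 1 - s) (u := 1 - r) (by linarith) (by linarith)
      (by linarith) (by linarith)
    have := mul_pos (sub_pos.mpr hr) rE
    linarith

lemma core {α A B : ℝ} (hα0 : 0 < α) (hA : 0 < A) (hB : 0 < B) (hAB : A + B < 1)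
    (h1 : phiD α B + phiD α (1 - A) + phiD α (1 - B) ≤ A)
    (h2 : phiD α A + phiD α (1 - B) + phiD α (1 - A) ≤ B)
    (h3 : phiD α B + phiD α A ≤ 1 - A - B)
    (hst : phiD α B + phiD α (1 - A) + phiD α (1 - B) < A ∨
      phiD α A + phiD α (1 - B) + phiD α (1 - A) < B ∨
      phiD α B + phiD α A < 1 - A - B) :
    ∃ r, 0 < r ∧ r < 1 / 2 ∧ phiD α r + 2 * phiD α (1 - r) < r ∧ 2 * phiD α r < 1 - 2 * r := by
  have hα : 1 < α := by
    by_contra! hc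
    have key : ∀ t, 0 < t → t < 1 → 1 - t ≤ phiD α t := by
      intro t t0 t1
      unfold phiD
      rw [le_div_iff₀ (phiD_den hα0 t0 t1)]
      nlinarith [mul_nonneg (mul_nonneg (sub_nonneg.mpr hc) t0.le) (sub_nonneg.mpr t1.le)]
    have := key A hA (by linarith)
    have := key B hB (by linarith)
    linarith
  by_cases hne : A = B
  · subst hne
    apply core_sym hα hA (by linarith) (by linarith) (by linarith)
    rcases hst with h | h | h
    · left; linarith
    · left; linarith
    · right; linarith
  · have m1 := phiD_mid hα hA (by linarith) hB (by linarith) hne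
    have m2 := phiD_mid hα (t := 1 - A) (u := 1 - B) (by linarith) (by linarith) (by linarith)
      (by linarith) (fun h => hne (by linarith))
    have e : (1 - A + (1 - B)) / 2 = 1 - (A + B) / 2 := by ring
    rw [e] at m2
    exact ⟨(A + B) / 2, by linarith, by linarith, by linarith, by linarith⟩

theorem stmt11 (y : Fin 8 → ℝ) (hy : y ∈ DeltaSeven) (hmin : FD y = alphaD) :
    ∀ j k : Fin 8, fD y j = fD y k := by
  obtain ⟨hpos, hsum⟩ := hy
  simp only [Fin.sum_univ_eight] at hsum
  have p0 := hpos 0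
  have p1 := hpos 1
  have p2 := hpos 2
  have p3 := hpos 3
  have p4 := hpos 4
  have p5 := hpos 5
  have p6 := hpos 6
  have p7 := hpos 7
  have sigpos : ∀ t, 0 < t → t < 1 → 0 < sigD t := fun t h0 h1 => div_pos (by linarith) h0
  -- values in the open simplex are nonnegative
  have fpos : ∀ x ∈ DeltaSeven, 0 < FD x := by
    rintro x ⟨hx, hs⟩
    simp only [Fin.sum_univ_eight] at hs
    have q0 := hx 0
    have q1 := hx 1
    have q2 := hx 2
    have q3 := hx 3
    have q4 := hx 4
    have q5 := hx 5
    have q6 := hx 6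
    have q7 := hx 7
    have hle : fD x 0 ≤ FD x := Finset.le_sup' (fD x) (Finset.mem_univ 0)
    refine lt_of_lt_of_le ?_ hle
    exact mul_pos (sigpos _ (by linarith) (by linarith)) (sigpos _ (by linarith) (by linarith))
  have hα := fpos y ⟨hpos, by simpa only [Fin.sum_univ_eight] using hsum⟩
  have hge : ∀ x ∈ DeltaSeven, FD y ≤ FD x := by
    intro x hx
    rw [hmin]
    exact csInf_le ⟨0, by rintro _ ⟨z, hz, rfl⟩; exact (fpos z hz).le⟩ ⟨x, hx, rfl⟩
  have hle : ∀ i, fD y i ≤ FD y := fun i => Finset.le_sup' (fD y) (Finset.mem_univ i)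
  suffices hall : ∀ i, fD y i = FD y by
    intro j k
    rw [hall j, hall k]
  by_contra hcon
  push Not at hcon
  obtain ⟨j, hj⟩ := hcon
  have hj : fD y j < FD y := lt_of_le_of_ne (hle j) hj
  set α := FD y with hαdef
  obtain ⟨A, hA⟩ : ∃ A, A = y 0 + y 1 + y 2 := ⟨_, rfl⟩
  obtain ⟨B, hB⟩ : ∃ B, B = y 3 + y 4 + y 5 := ⟨_, rfl⟩
  have eB : y 3 + y 4 + y 5 = B := hB.symm
  have eA : y 0 + y 1 + y 2 = A := hA.symm
  have eA' : y 3 + y 4 + y 5 + y 6 + y 7 = 1 - A := by linarith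
  have eB' : y 0 + y 1 + y 2 + y 6 + y 7 = 1 - B := by linarith
  have A0 : 0 < A := by linarith
  have B0 : 0 < B := by linarith
  have AB : A + B < 1 := by linarith
  -- lower bounds vector
  have hf : fD y = fun i => sigD ((![B, 1 - A, 1 - B, A, 1 - B, 1 - A, B, A] : Fin 8 → ℝ) i)
      * sigD (y i) := by
    funext i
    unfold fD
    rw [eB', eA', eA, eB]
    fin_cases i <;> rfl
  have hT : ∀ i, 0 < (![B, 1 - A, 1 - B, A, 1 - B, 1 - A, B, A] : Fin 8 → ℝ) i ∧
      (![B, 1 - A, 1 - B, A, 1 - B, 1 - A, B, A] : Fin 8 → ℝ) i < 1 := by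
    intro i
    fin_cases i <;> simp <;> constructor <;> linarith
  have hlb : ∀ i, phiD α ((![B, 1 - A, 1 - B, A, 1 - B, 1 - A, B, A] : Fin 8 → ℝ) i) ≤ y i := by
    intro i
    rw [← sig_le_iff hα (hT i).1 (hT i).2 (hpos i)]
    have := hle i
    rwa [hf] at this
  have hjb : phiD α ((![B, 1 - A, 1 - B, A, 1 - B, 1 - A, B, A] : Fin 8 → ℝ) j) < y j := by
    rw [← sig_lt_iff hα (hT j).1 (hT j).2 (hpos j)]
    rwa [hf] at hj
  have l0 : phiD α B ≤ y 0 := hlb 0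
  have l1 : phiD α (1 - A) ≤ y 1 := hlb 1
  have l2 : phiD α (1 - B) ≤ y 2 := hlb 2
  have l3 : phiD α A ≤ y 3 := hlb 3
  have l4 : phiD α (1 - B) ≤ y 4 := hlb 4
  have l5 : phiD α (1 - A) ≤ y 5 := hlb 5
  have l6 : phiD α B ≤ y 6 := hlb 6
  have l7 : phiD α A ≤ y 7 := hlb 7
  obtain ⟨r, r0, r1, rP, rQ⟩ := core hα A0 B0 AB (by linarith) (by linarith) (by linarith) (by
    fin_cases j
    · have h : phiD α B < y 0 := hjb
      left; linarith
    · have h : phiD α (1 - A) < y 1 := hjb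
      left; linarith
    · have h : phiD α (1 - B) < y 2 := hjb
      left; linarith
    · have h : phiD α A < y 3 := hjb
      right; left; linarith
    · have h : phiD α (1 - B) < y 4 := hjb
      right; left; linarith
    · have h : phiD α (1 - A) < y 5 := hjb
      right; left; linarith
    · have h : phiD α B < y 6 := hjb
      right; right; linarith
    · have h : phiD α A < y 7 := hjb
      right; right; linarith)
  -- build a strictly better point
  have u0 := phiD_pos hα r0 (by linarith)
  have v0 := phiD_pos hα (t := 1 - r) (by linarith) (by linarith)
  obtain ⟨e, he⟩ : ∃ e, e = (r - (phiD α r + 2 * phiD α (1 - r))) / 3 := ⟨_, rfl⟩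
  obtain ⟨p, hp⟩ : ∃ p, p = phiD α r + e := ⟨_, rfl⟩
  obtain ⟨q, hq⟩ : ∃ q, q = phiD α (1 - r) + e := ⟨_, rfl⟩
  obtain ⟨c, hc⟩ : ∃ c, c = (1 - 2 * r) / 2 := ⟨_, rfl⟩
  have hpq : p + q + q = r := by linarith
  have hpq' : p + q + q + c + c = 1 - r := by linarith
  have hpp : phiD α r < p := by linarith
  have hqq : phiD α (1 - r) < q := by linarith
  have hcc : phiD α r < c := by linarith
  have p_0 : 0 < p := by linarith
  have q_0 : 0 < q := by linarith
  have c_0 : 0 < c := by linarith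
  have hx : (![p, q, q, p, q, q, c, c] : Fin 8 → ℝ) ∈ DeltaSeven := by
    constructor
    · intro i
      fin_cases i <;> assumption
    · rw [Fin.sum_univ_eight]
      change p + q + q + p + q + q + c + c = 1
      linarith
  have hlt : FD ![p, q, q, p, q, q, c, c] < α := by
    unfold FD
    rw [Finset.sup'_lt_iff]
    intro i _
    have s1 : sigD r * sigD p < α := (sig_lt_iff hα r0 (by linarith) p_0).2 hpp
    have s2 : sigD (1 - r) * sigD q < α :=
      (sig_lt_iff hα (by linarith) (by linarith) q_0).2 hqq
    have s3 : sigD r * sigD c < α := (sig_lt_iff hα r0 (by linarith) c_0).2 hcc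
    rw [← hpq'] at s2
    rw [← hpq] at s1 s3
    fin_cases i <;> assumption
  exact absurd (hge _ hx) (not_le.mpr hlt)
end

section
/- For every α in the interval [9, 5+3√2], neither G^+(α) = 1 nor G^−(α) = 1, where g^±(α) = ((1−α²)√α + α³ + α ± √(d(α))) / (2(−1 + (α³−α)√α + α²)), d(α) = b(α) − c(α) with b(α) = α⁶ + 6α³ + α² + 4 + (4α⁴ + 6α + 4)√α and c(α) = 3α⁵ + 6α⁴ + 3α + (2α⁵ + 4α³ + 8α²)√α, and G^±(α) = ((√α+1)(α−1)(g^±(α))² + 2(α−1)g^±(α) + √α + 3) / ((√α+1)((α−1)g^±(α) + 1)). -/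
noncomputable def bG (a : ℝ) : ℝ :=
  a ^ 6 + 6 * a ^ 3 + a ^ 2 + 4 + (4 * a ^ 4 + 6 * a + 4) * Real.sqrt a

noncomputable def cG (a : ℝ) : ℝ :=
  3 * a ^ 5 + 6 * a ^ 4 + 3 * a + (2 * a ^ 5 + 4 * a ^ 3 + 8 * a ^ 2) * Real.sqrt a

noncomputable def dG (a : ℝ) : ℝ := bG a - cG a

noncomputable def gPlus (a : ℝ) : ℝ :=
  ((1 - a ^ 2) * Real.sqrt a + a ^ 3 + a + Real.sqrt (dG a)) /
    (2 * (-1 + (a ^ 3 - a) * Real.sqrt a + a ^ 2))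

noncomputable def gMinus (a : ℝ) : ℝ :=
  ((1 - a ^ 2) * Real.sqrt a + a ^ 3 + a - Real.sqrt (dG a)) /
    (2 * (-1 + (a ^ 3 - a) * Real.sqrt a + a ^ 2))

noncomputable def GG (g a : ℝ) : ℝ :=
  ((Real.sqrt a + 1) * (a - 1) * g ^ 2 + 2 * (a - 1) * g + Real.sqrt a + 3) /
    ((Real.sqrt a + 1) * ((a - 1) * g + 1))

/-- The quadratic numerator is positive for arguments at most `0.17`. -/
lemma quad_pos (s g : ℝ) (h3 : 3 ≤ s) (hs : s ≤ 3.041) (hg : g ≤ 0.17) :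
    0 < (s + 1) * (s ^ 2 - 1) * g ^ 2 + (s ^ 2 - 1) * (1 - s) * g + 2 := by
  have h1 : 0 ≤ s ^ 2 - 1 := by nlinarith
  have h2 : s ^ 2 - 1 ≤ 8.248 := by nlinarith
  have h4 : -0.2312 ≤ (s + 1) * g ^ 2 + (1 - s) * g := by
    rcases le_total g 0 with h | h
    · nlinarith [mul_nonneg (by linarith : 0 ≤ s - 1) (neg_nonneg.2 h),
        mul_nonneg (by linarith : 0 ≤ s + 1) (sq_nonneg g)]
    · nlinarith [mul_nonneg (by linarith : 0 ≤ 3.041 - s) (mul_nonneg h (by linarith : 0 ≤ 1 - g)),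
        mul_nonneg h (by linarith : 0 ≤ 0.17 - g)]
  nlinarith [mul_nonneg h1 (by linarith : 0 ≤ (s + 1) * g ^ 2 + (1 - s) * g + 0.2312)]

lemma GG_ne_one (s g : ℝ) (h3 : 3 ≤ s) (hs : s ≤ 3.041) (hg : g ≤ 0.17) :
    GG g (s ^ 2) ≠ 1 := by
  intro h
  unfold GG at h
  rw [Real.sqrt_sq (by linarith)] at h
  have hne : (s + 1) * ((s ^ 2 - 1) * g + 1) ≠ 0 := by
    intro h0
    rw [h0, div_zero] at h
    exact zero_ne_one h
  rw [div_eq_one_iff_eq hne] at h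
  have := quad_pos s g h3 hs hg
  nlinarith

lemma dG_le (s : ℝ) (h3 : 3 ≤ s) (hs : s ≤ 3.041) : dG (s ^ 2) ≤ 224 ^ 2 := by
  unfold dG bG cG
  rw [Real.sqrt_sq (by linarith)]
  obtain ⟨t, rfl⟩ : ∃ t, s = 3 + t := ⟨s - 3, by ring⟩
  have h0 : 0 ≤ t := by linarith
  have h1 : t ≤ 0.041 := by linarith
  have hp : ∀ k : ℕ, 0 ≤ t ^ k ∧ t ^ k ≤ 0.041 ^ k := fun k =>
    ⟨pow_nonneg h0 k, pow_le_pow_left₀ h0 h1 k⟩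
  have p2 := hp 2
  have p3 := hp 3
  have p4 := hp 4
  have p5 := hp 5
  have p6 := hp 6
  have p7 := hp 7
  have p8 := hp 8
  have p9 := hp 9
  have p10 := hp 10
  have p11 := hp 11
  have p12 := hp 12
  clear hp
  ring_nf
  norm_num at *
  linarith

lemma lin_bound (s : ℝ) (h3 : 3 ≤ s) (hs : s ≤ 3.041) :
    0 < 2 * (-1 + ((s ^ 2) ^ 3 - s ^ 2) * s + (s ^ 2) ^ 2) ∧
    (1 - (s ^ 2) ^ 2) * s + (s ^ 2) ^ 3 + s ^ 2 + 224 ≤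
      0.17 * (2 * (-1 + ((s ^ 2) ^ 3 - s ^ 2) * s + (s ^ 2) ^ 2)) := by
  obtain ⟨t, rfl⟩ : ∃ t, s = 3 + t := ⟨s - 3, by ring⟩
  have h0 : 0 ≤ t := by linarith
  have h1 : t ≤ 0.041 := by linarith
  have hp : ∀ k : ℕ, 0 ≤ t ^ k ∧ t ^ k ≤ 0.041 ^ k := fun k =>
    ⟨pow_nonneg h0 k, pow_le_pow_left₀ h0 h1 k⟩
  have p2 := hp 2
  have p3 := hp 3
  have p4 := hp 4
  have p5 := hp 5
  have p6 := hp 6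
  have p7 := hp 7
  clear hp
  ring_nf
  norm_num at *
  constructor <;> linarith

theorem stmt12 :
    ∀ a ∈ Set.Icc (9 : ℝ) (5 + 3 * Real.sqrt 2),
      GG (gPlus a) a ≠ 1 ∧ GG (gMinus a) a ≠ 1 := by
  intro a ha
  obtain ⟨ha1, ha2⟩ := ha
  have h2 : Real.sqrt 2 ≤ 1.4143 := by
    rw [Real.sqrt_le_left (by norm_num)]
    norm_num
  obtain ⟨s, hs0, rfl⟩ : ∃ s : ℝ, 0 ≤ s ∧ a = s ^ 2 :=
    ⟨Real.sqrt a, Real.sqrt_nonneg a, (Real.sq_sqrt (by linarith)).symm⟩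
  have h3 : 3 ≤ s := by nlinarith
  have hs : s ≤ 3.041 := by nlinarith
  obtain ⟨hD, hN⟩ := lin_bound s h3 hs
  have hr : Real.sqrt (dG (s ^ 2)) ≤ 224 := by
    rw [Real.sqrt_le_left (by norm_num)]
    exact dG_le s h3 hs
  have hr0 := Real.sqrt_nonneg (dG (s ^ 2))
  constructor
  · apply GG_ne_one s _ h3 hs
    unfold gPlus
    rw [Real.sqrt_sq hs0, div_le_iff₀ hD]
    linarith
  · apply GG_ne_one s _ h3 hs
    unfold gMinus
    rw [Real.sqrt_sq hs0, div_le_iff₀ hD]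
    linarith
end

section
/- For every α in the interval [9, 5+3√2], neither H^+(α) = 1/2 nor H^−(α) = 1/2, where h^±(α) = ((α−1)² ± √((α−1)(α³−3α²−5α−9))) / (2(α²−1)) and H^±(α) = ((α+1)(α²−1)(h^±(α))² + 5(α²−1)h^±(α) + α² + 9α − 4) / ((α+1)(α²−1)h^±(α) + (α+1)(3α−1)). -/
noncomputable def hPlus (a : ℝ) : ℝ :=
  ((a - 1) ^ 2 + Real.sqrt ((a - 1) * (a ^ 3 - 3 * a ^ 2 - 5 * a - 9))) / (2 * (a ^ 2 - 1))

noncomputable def hMinus (a : ℝ) : ℝ :=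
  ((a - 1) ^ 2 - Real.sqrt ((a - 1) * (a ^ 3 - 3 * a ^ 2 - 5 * a - 9))) / (2 * (a ^ 2 - 1))

noncomputable def HH (h a : ℝ) : ℝ :=
  ((a + 1) * (a ^ 2 - 1) * h ^ 2 + 5 * (a ^ 2 - 1) * h + a ^ 2 + 9 * a - 4) /
    ((a + 1) * (a ^ 2 - 1) * h + (a + 1) * (3 * a - 1))

theorem quad_of_eq (a s h : ℝ) (ha : 9 ≤ a)
    (hs : s ^ 2 = (a - 1) * (a ^ 3 - 3 * a ^ 2 - 5 * a - 9))
    (hh : h = ((a - 1) ^ 2 + s) / (2 * (a ^ 2 - 1))) :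
    (a ^ 2 - 1) * h ^ 2 - (a - 1) ^ 2 * h + 2 = 0 := by
  have hp : (0 : ℝ) < a ^ 2 - 1 := by nlinarith
  have h2 : s = 2 * (a ^ 2 - 1) * h - (a - 1) ^ 2 := by
    rw [hh]; field_simp; ring
  rw [h2] at hs
  have : 4 * (a ^ 2 - 1) * ((a ^ 2 - 1) * h ^ 2 - (a - 1) ^ 2 * h + 2) = 0 := by
    linear_combination hs
  rcases mul_eq_zero.mp this with h0 | h0
  · linarith
  · exact h0

theorem HH_ne (a h : ℝ) (ha : 9 ≤ a) (ha' : a < 11)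
    (hq : (a ^ 2 - 1) * h ^ 2 - (a - 1) ^ 2 * h + 2 = 0) : HH h a ≠ 1 / 2 := by
  have hp : (0 : ℝ) < a ^ 2 - 1 := by nlinarith
  have hpos : 0 < h := by
    by_contra hn
    have h1 : 0 ≤ (a ^ 2 - 1) * h ^ 2 := by positivity
    have h2 : 0 ≤ (a - 1) ^ 2 * (-h) := mul_nonneg (sq_nonneg _) (by linarith)
    linarith
  have hD : 0 < (a + 1) * (a ^ 2 - 1) * h + (a + 1) * (3 * a - 1) := by
    have h1 : 0 < a + 1 := by linarith
    have h2 : 0 < 3 * a - 1 := by linarith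
    positivity
  intro he
  unfold HH at he
  rw [div_eq_div_iff hD.ne' two_ne_zero] at he
  have key : (a ^ 2 - 1) * (a + 7) * h + (a - 1) * (11 - a) = 0 := by
    linear_combination he - 2 * (a + 1) * hq
  have h3 : 0 < a + 7 := by linarith
  have h4 : 0 < (a ^ 2 - 1) * (a + 7) * h := by positivity
  have h5 : 0 < (a - 1) * (11 - a) := mul_pos (by linarith) (by linarith)
  linarith

theorem stmt13 :
    ∀ a ∈ Set.Icc (9 : ℝ) (5 + 3 * Real.sqrt 2),
      HH (hPlus a) a ≠ 1 / 2 ∧ HH (hMinus a) a ≠ 1 / 2 := by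
  intro a ⟨h1, h2⟩
  have hs2 : Real.sqrt 2 < 2 := by
    rw [Real.sqrt_lt' (by norm_num)]; norm_num
  have h3 : a < 11 := by linarith
  have hnn : 0 ≤ (a - 1) * (a ^ 3 - 3 * a ^ 2 - 5 * a - 9) := by
    apply mul_nonneg (by linarith)
    have h5 : 0 ≤ a ^ 2 * (a - 9) := mul_nonneg (sq_nonneg _) (by linarith)
    nlinarith
  have hsq := Real.sq_sqrt hnn
  refine ⟨HH_ne a _ h1 h3 (quad_of_eq a _ _ h1 hsq rfl),
    HH_ne a _ h1 h3 (quad_of_eq a (-Real.sqrt _) _ h1 (by rw [neg_sq]; exact hsq) ?_)⟩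
  rw [hMinus, sub_eq_add_neg ((a - 1) ^ 2)]
end

section
/- The minimum of F† on Δ^7 is attained only at the point x̄ with x̄_i = (√2−1)/2 for i ∈ {1,4,7,8} and x̄_i = (3−2√2)/4 for i ∈ {2,3,5,6}: if x ∈ Δ^7 satisfies F†(x) = inf_{y ∈ Δ^7} F†(y), then x = x̄. -/
lemma aux_prod (s B x : ℝ) (hB : 0 < B) (hx : 0 < x)
    (h : sigD B * sigD x ≤ 5 + 3 * s) : (1 - B) * (1 - x) ≤ (5 + 3 * s) * (B * x) := by
  unfold sigD at h
  rw [div_mul_div_comm, div_le_iff₀ (mul_pos hB hx)] at h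
  exact h

lemma aux_p (s B x : ℝ) (hs : s * s = 2) (hs1 : 1 < s) (hs2 : s < 3 / 2)
    (hB : 0 < B) (hB1 : B < 1) (hx : 0 < x)
    (h : sigD B * sigD x ≤ 5 + 3 * s) :
    (s - 1) / 2 - (3 - s) / 2 * (B - (1 - s / 2)) + (B - (1 - s / 2)) ^ 2 / 2 ≤ x := by
  have h1 := aux_prod s B x hB hx h
  have hpos : 0 < 1 + (4 + 3 * s) * B := by positivity
  have h2 : 1 - B ≤ x * (1 + (4 + 3 * s) * B) := by linarith
  have key : 1 - B - (1 + (4 + 3 * s) * B) *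
      ((s - 1) / 2 - (3 - s) / 2 * (B - (1 - s / 2)))
      = (6 + 5 * s) / 2 * (B - (1 - s / 2)) ^ 2 := by
    grind
  have h3 : (1 + (4 + 3 * s) * B) * ((B - (1 - s / 2)) ^ 2 / 2)
      ≤ (6 + 5 * s) / 2 * (B - (1 - s / 2)) ^ 2 := by
    have : 1 + (4 + 3 * s) * B ≤ 6 + 5 * s := by nlinarith
    nlinarith [mul_le_mul_of_nonneg_right this (sq_nonneg (B - (1 - s / 2)))]
  refine le_of_mul_le_mul_left ?_ hpos
  linarith

lemma aux_q (s D A x : ℝ) (hs : s * s = 2) (hs1 : 1 < s) (hs2 : s < 3 / 2)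
    (hD : 0 < D) (hA : 0 < A) (hAD : A + D = 1) (hx : 0 < x)
    (h : sigD D * sigD x ≤ 5 + 3 * s) :
    (3 - 2 * s) / 4 + (3 - s) / 8 * (A - (1 - s / 2)) ≤ x := by
  have h1 := aux_prod s D x hD hx h
  obtain rfl : D = 1 - A := by linarith
  have hpos : 0 < 1 + (4 + 3 * s) * (1 - A) := by positivity
  have h2 : A ≤ x * (1 + (4 + 3 * s) * (1 - A)) := by linarith
  have key : A - (1 + (4 + 3 * s) * (1 - A)) *
      ((3 - 2 * s) / 4 + (3 - s) / 8 * (A - (1 - s / 2)))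
      = (6 + 5 * s) / 8 * (A - (1 - s / 2)) ^ 2 := by
    grind
  have h3 : 0 ≤ (6 + 5 * s) / 8 * (A - (1 - s / 2)) ^ 2 := by positivity
  refine le_of_mul_le_mul_left ?_ hpos
  linarith

lemma aux_main (s : ℝ) (hs : s * s = 2) (hs1 : 1 < s) (hs2 : s < 3 / 2)
    (x : Fin 8 → ℝ) (hx : x ∈ DeltaSeven) (h : ∀ i, fD x i ≤ 5 + 3 * s) :
    x = ![(s - 1) / 2, (3 - 2 * s) / 4, (3 - 2 * s) / 4,
    (s - 1) / 2, (3 - 2 * s) / 4, (3 - 2 * s) / 4, (s - 1) / 2, (s - 1) / 2] := by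
  obtain ⟨hp, hsum⟩ := hx
  simp only [Fin.sum_univ_eight] at hsum
  have p0 := hp 0
  have p1 := hp 1
  have p2 := hp 2
  have p3 := hp 3
  have p4 := hp 4
  have p5 := hp 5
  have p6 := hp 6
  have p7 := hp 7
  have b0 := aux_p s (x 3 + x 4 + x 5) (x 0) hs hs1 hs2 (by linarith) (by linarith) p0 (h 0)
  have b1 := aux_q s (x 3 + x 4 + x 5 + x 6 + x 7) (x 0 + x 1 + x 2) (x 1) hs hs1 hs2
    (by linarith) (by linarith) (by linarith) p1 (h 1)
  have b2 := aux_q s (x 0 + x 1 + x 2 + x 6 + x 7) (x 3 + x 4 + x 5) (x 2) hs hs1 hs2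
    (by linarith) (by linarith) (by linarith) p2 (h 2)
  have b3 := aux_p s (x 0 + x 1 + x 2) (x 3) hs hs1 hs2 (by linarith) (by linarith) p3 (h 3)
  have b4 := aux_q s (x 0 + x 1 + x 2 + x 6 + x 7) (x 3 + x 4 + x 5) (x 4) hs hs1 hs2
    (by linarith) (by linarith) (by linarith) p4 (h 4)
  have b5 := aux_q s (x 3 + x 4 + x 5 + x 6 + x 7) (x 0 + x 1 + x 2) (x 5) hs hs1 hs2
    (by linarith) (by linarith) (by linarith) p5 (h 5)
  have b6 := aux_p s (x 3 + x 4 + x 5) (x 6) hs hs1 hs2 (by linarith) (by linarith) p6 (h 6)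
  have b7 := aux_p s (x 0 + x 1 + x 2) (x 7) hs hs1 hs2 (by linarith) (by linarith) p7 (h 7)
  obtain ⟨u, hu⟩ : ∃ u, u = x 0 + x 1 + x 2 - (1 - s / 2) := ⟨_, rfl⟩
  obtain ⟨v, hv⟩ : ∃ v, v = x 3 + x 4 + x 5 - (1 - s / 2) := ⟨_, rfl⟩
  rw [← hv] at b0 b2 b4 b6
  rw [← hu] at b1 b3 b5 b7
  -- the weighted combination of the two kinds of budget constraints
  have e1 : (u ^ 2 + v ^ 2) / 2 ≤ (u + v) * (1 + (3 - s) / 4) := by linarith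
  have e2 : (u ^ 2 + v ^ 2) / 2 ≤ -(u + v) * ((s - 1) / 2) := by linarith
  have e3 := mul_le_mul_of_nonneg_left e1 (by linarith : 0 ≤ (s - 1) / 2)
  have e4 := mul_le_mul_of_nonneg_left e2 (by linarith : 0 ≤ 1 + (3 - s) / 4)
  have e5 : (s - 1) / 2 * ((u ^ 2 + v ^ 2) / 2) +
      (1 + (3 - s) / 4) * ((u ^ 2 + v ^ 2) / 2) ≤ 0 := by linarith
  have e6 : u ^ 2 + v ^ 2 ≤ 0 := by
    refine le_of_mul_le_mul_left ?_ (by linarith : 0 < ((s - 1) / 2 + (1 + (3 - s) / 4)) / 2)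
    linarith
  have hu0 : u = 0 := pow_eq_zero_iff two_ne_zero |>.1
    (le_antisymm (by linarith [sq_nonneg v]) (sq_nonneg u))
  have hv0 : v = 0 := pow_eq_zero_iff two_ne_zero |>.1
    (le_antisymm (by linarith [sq_nonneg u]) (sq_nonneg v))
  subst hu0 hv0
  ext i
  fin_cases i <;> simp <;> linarith

theorem stmt15 (x : Fin 8 → ℝ) (hx : x ∈ DeltaSeven)
    (hmin : FD x = sInf (FD '' DeltaSeven)) : x = xbar := by
  obtain ⟨s, hsd⟩ : ∃ s, s = Real.sqrt 2 := ⟨_, rfl⟩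
  have hs : s * s = 2 := by rw [hsd]; exact Real.mul_self_sqrt (by norm_num)
  have hs0 : 0 ≤ s := hsd ▸ Real.sqrt_nonneg 2
  have hs1 : 1 < s := by nlinarith
  have hs2 : s < 3 / 2 := by nlinarith
  have hsig : ∀ t : ℝ, 0 < t → t < 1 → 0 < sigD t := fun t h0 h1 =>
    div_pos (by linarith) h0
  have hxb : xbar ∈ DeltaSeven := by
    unfold xbar
    rw [← hsd]
    refine ⟨fun i => ?_, ?_⟩
    · fin_cases i <;> simp <;> linarith
    · simp [Fin.sum_univ_eight]; ring
  have v1 : sigD (1 - s / 2) * sigD ((s - 1) / 2) = 5 + 3 * s := by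
    unfold sigD
    have a1 : 1 - s / 2 ≠ 0 := by linarith
    have a2 : (s - 1) / 2 ≠ 0 := by linarith
    rw [div_mul_div_comm, div_eq_iff (mul_ne_zero a1 a2)]
    grind
  have v2 : sigD (s / 2) * sigD ((3 - 2 * s) / 4) = 5 + 3 * s := by
    unfold sigD
    have a1 : s / 2 ≠ 0 := by linarith
    have a2 : (3 - 2 * s) / 4 ≠ 0 := by linarith
    rw [div_mul_div_comm, div_eq_iff (mul_ne_zero a1 a2)]
    grind
  have hFb : FD xbar ≤ 5 + 3 * s := by
    unfold FD
    refine Finset.sup'_le _ _ fun i _ => ?_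
    have w1 : (s - 1) / 2 + (3 - 2 * s) / 4 + (3 - 2 * s) / 4 = 1 - s / 2 := by ring
    have w2 : 1 - s / 2 + (s - 1) / 2 + (s - 1) / 2 = s / 2 := by ring
    unfold xbar fD
    rw [← hsd]
    fin_cases i <;> simp [w1, w2, v1, v2]
  have hbdd : BddBelow (FD '' DeltaSeven) := by
    refine ⟨0, ?_⟩
    rintro _ ⟨y, ⟨hp, hsum⟩, rfl⟩
    simp only [Fin.sum_univ_eight] at hsum
    have p0 := hp 0
    have p1 := hp 1
    have p2 := hp 2
    have p3 := hp 3
    have p4 := hp 4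
    have p5 := hp 5
    have p6 := hp 6
    have p7 := hp 7
    have h0 : 0 < fD y 0 := mul_pos (hsig (y 3 + y 4 + y 5) (by linarith) (by linarith))
      (hsig (y 0) (by linarith) (by linarith))
    exact h0.le.trans (Finset.le_sup' (fD y) (Finset.mem_univ 0))
  have hle : FD x ≤ 5 + 3 * s := by
    rw [hmin]
    exact (csInf_le hbdd ⟨xbar, hxb, rfl⟩).trans hFb
  have := aux_main s hs hs1 hs2 x hx fun i =>
    (Finset.le_sup' (fD x) (Finset.mem_univ i)).trans hle
  rw [this, hsd]
  rfl
end

section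
/- Let Δ = {(x_1, x_2) ∈ ℝ² : 0 < x_1 < 1/2 and 0 < x_2 < (1/2)(1/2 − x_1)}, and define on Δ the functions f_1(x_1,x_2) = σ(x_1+2x_2)·σ(x_1), f_2(x_1,x_2) = σ(x_2)/σ(x_1+2x_2), f_7(x_1,x_2) = σ(x_1+2x_2)·σ(1/2−x_1−2x_2). Then the minimum of max(f_1, f_2, f_7) over Δ equals 5+3√2, and it is attained at the point ((√2−1)/2, (3−2√2)/4). -/
def DeltaTwo : Set (ℝ × ℝ) :=
  {p | 0 < p.1 ∧ p.1 < 1 / 2 ∧ 0 < p.2 ∧ p.2 < (1 / 2) * (1 / 2 - p.1)}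

noncomputable def Fmax (p : ℝ × ℝ) : ℝ :=
  max (max (sigD (p.1 + 2 * p.2) * sigD p.1)
           (sigD p.2 / sigD (p.1 + 2 * p.2)))
      (sigD (p.1 + 2 * p.2) * sigD (1 / 2 - p.1 - 2 * p.2))

theorem stmt17 :
    ((Real.sqrt 2 - 1) / 2, (3 - 2 * Real.sqrt 2) / 4) ∈ DeltaTwo ∧
    Fmax ((Real.sqrt 2 - 1) / 2, (3 - 2 * Real.sqrt 2) / 4) = 5 + 3 * Real.sqrt 2 ∧
    ∀ p ∈ DeltaTwo, 5 + 3 * Real.sqrt 2 ≤ Fmax p := by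
  have hr : Real.sqrt 2 ^ 2 = 2 := Real.sq_sqrt (by norm_num)
  have hr0 : 0 ≤ Real.sqrt 2 := Real.sqrt_nonneg 2
  generalize Real.sqrt 2 = r at hr hr0
  have h1 : 1.414 < r := by nlinarith
  have h2 : r < 1.415 := by nlinarith
  refine ⟨⟨?_, ?_, ?_, ?_⟩, ?_, ?_⟩
  · dsimp only; linarith
  · dsimp only; linarith
  · dsimp only; linarith
  · dsimp only; linarith
  · have e1 : sigD ((r - 1) / 2) = 2 * r + 1 := by
      unfold sigD
      rw [div_eq_iff (by linarith)]
      nlinarith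
    have e2 : sigD ((r - 1) / 2 + 2 * ((3 - 2 * r) / 4)) = r + 1 := by
      unfold sigD
      rw [div_eq_iff (by linarith)]
      nlinarith
    have e3 : sigD ((3 - 2 * r) / 4) = 11 + 8 * r := by
      unfold sigD
      rw [div_eq_iff (by linarith)]
      nlinarith
    have e4 : (1 / 2 - (r - 1) / 2 - 2 * ((3 - 2 * r) / 4)) = (r - 1) / 2 := by ring
    unfold Fmax
    dsimp only
    rw [e4, e1, e2, e3]
    have e5 : (r + 1) * (2 * r + 1) = 5 + 3 * r := by nlinarith
    have e6 : (11 + 8 * r) / (r + 1) = 5 + 3 * r := by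
      rw [div_eq_iff (by linarith)]
      nlinarith
    rw [e5, e6]
    simp
  · rintro ⟨x, y⟩ ⟨hx, hx2, hy, hy2⟩
    dsimp only at hx hx2 hy hy2
    by_contra hcon
    rw [not_le] at hcon
    unfold Fmax at hcon
    dsimp only at hcon
    rw [max_lt_iff, max_lt_iff] at hcon
    obtain ⟨⟨f1, f2⟩, f7⟩ := hcon
    obtain ⟨s, hs⟩ : ∃ s, s = x + 2 * y := ⟨_, rfl⟩
    have e4 : 1 / 2 - x - 2 * y = 1 / 2 - s := by rw [hs]; ring
    rw [e4] at f7
    rw [← hs] at f1 f2 f7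
    have hs0 : 0 < s := by linarith
    have hs1 : s < 1 / 2 := by linarith
    -- the third function bounds s from above
    have g7 : s < 1 - r / 2 := by
      unfold sigD at f7
      rw [div_mul_div_comm, div_lt_iff₀ (mul_pos hs0 (by linarith))] at f7
      by_contra hc
      rw [not_lt] at hc
      have : 0 ≤ (s - (1 - r / 2)) * (s - (r - 1) / 2) :=
        mul_nonneg (by linarith) (by linarith)
      nlinarith
    obtain ⟨a, ha⟩ : ∃ a, a = sigD s := ⟨_, rfl⟩
    rw [← ha] at f1 f2
    have has : (1 + a) * s = 1 := by
      rw [ha]; unfold sigD; field_simp; ring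
    have haa : 1 + r < a := by
      by_contra hc
      rw [not_lt] at hc
      nlinarith
    have ha0 : 0 < a := by linarith
    have k1 : a < (a + (5 + 3 * r)) * x := by
      unfold sigD at f1
      rw [← mul_div_assoc, div_lt_iff₀ hx] at f1
      nlinarith
    have k2 : 1 < (1 + (5 + 3 * r) * a) * y := by
      rw [div_lt_iff₀ ha0] at f2
      unfold sigD at f2
      rw [div_lt_iff₀ hy] at f2
      nlinarith
    obtain ⟨c, hc⟩ : ∃ c, c = 5 + 3 * r := ⟨_, rfl⟩
    rw [← hc] at k1 k2
    have hc0 : 0 < c := by linarith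
    have key : (a * (1 + c * a) + 2 * (a + c)) < (a + c) * (1 + c * a) * s := by
      have := mul_lt_mul_of_pos_right k1 (show 0 < 1 + c * a by positivity)
      have := mul_lt_mul_of_pos_right k2 (show 0 < a + c by positivity)
      rw [hs]; nlinarith
    have key2 : (a * (1 + c * a) + 2 * (a + c)) * (1 + a) < (a + c) * (1 + c * a) := by
      have := mul_lt_mul_of_pos_right key (show 0 < 1 + a by positivity)
      have e : (a + c) * (1 + c * a) * s * (1 + a) = (a + c) * (1 + c * a) := by
        linear_combination (a + c) * (1 + c * a) * has
      linarith
    have q : 0 < c * a ^ 2 + (14 + 8 * r) * a - (1 + 2 * r) := by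
      have : 0 < c * a ^ 2 := by positivity
      nlinarith
    have fin := mul_pos (sub_pos.2 haa) q
    have e : (a * (1 + c * a) + 2 * (a + c)) * (1 + a) - (a + c) * (1 + c * a)
        = (a - (1 + r)) * (c * a ^ 2 + (14 + 8 * r) * a - (1 + 2 * r)) := by
      rw [hc]
      ring_nf
      have r2 : r ^ 2 = 2 := hr
      simp only [r2]
      ring
    linarith
end

section
/- Let g_1(x) = 3·(3+8x)/(1−8x) and g_2(x) = (1/3)·(1−x)/x for x ∈ (0, 1/8). Then inf_{x ∈ (0,1/8)} max(g_1(x), g_2(x)) = (17+2√97)/3, and this infimum is attained at the unique point t* = (√97−9)/32, at which g_1(t*) = g_2(t*). -/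
noncomputable def g1 (x : ℝ) : ℝ := 3 * ((3 + 8 * x) / (1 - 8 * x))

noncomputable def g2 (x : ℝ) : ℝ := (1 / 3) * ((1 - x) / x)

theorem stmt18 :
    sInf ((fun x => max (g1 x) (g2 x)) '' Set.Ioo (0 : ℝ) (1 / 8)) =
      (17 + 2 * Real.sqrt 97) / 3 ∧
    (Real.sqrt 97 - 9) / 32 ∈ Set.Ioo (0 : ℝ) (1 / 8) ∧
    max (g1 ((Real.sqrt 97 - 9) / 32)) (g2 ((Real.sqrt 97 - 9) / 32)) =
      (17 + 2 * Real.sqrt 97) / 3 ∧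
    g1 ((Real.sqrt 97 - 9) / 32) = g2 ((Real.sqrt 97 - 9) / 32) ∧
    ∀ x ∈ Set.Ioo (0 : ℝ) (1 / 8),
      max (g1 x) (g2 x) = (17 + 2 * Real.sqrt 97) / 3 → x = (Real.sqrt 97 - 9) / 32 := by
  have hs : Real.sqrt 97 * Real.sqrt 97 = 97 := Real.mul_self_sqrt (by norm_num)
  have hs0 : 0 ≤ Real.sqrt 97 := Real.sqrt_nonneg 97
  generalize Real.sqrt 97 = s at *
  have h9 : 9 < s := by nlinarith
  have h10 : s < 10 := by nlinarith
  have ht : (s - 9) / 32 ∈ Set.Ioo (0 : ℝ) (1 / 8) := ⟨by linarith, by linarith⟩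
  have e1 : g1 ((s - 9) / 32) = (17 + 2 * s) / 3 := by
    have : 1 - 8 * ((s - 9) / 32) ≠ 0 := by intro h; linarith
    unfold g1
    rw [mul_div_assoc', div_eq_iff this]
    linear_combination (1 / 6) * hs
  have e2 : g2 ((s - 9) / 32) = (17 + 2 * s) / 3 := by
    have : (s - 9) / 32 ≠ 0 := by intro h; linarith
    unfold g2
    rw [mul_div_assoc', div_eq_iff this]
    linear_combination (-1 / 48) * hs
  have k1 : ∀ x ∈ Set.Ioo (0 : ℝ) (1 / 8), (s - 9) / 32 < x → (17 + 2 * s) / 3 < g1 x := by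
    rintro x ⟨h0, h1⟩ h
    unfold g1
    rw [mul_div_assoc', lt_div_iff₀ (by linarith)]
    nlinarith [mul_pos (sub_pos.2 h) (by linarith : 0 < 17 + 2 * s)]
  have k2 : ∀ x ∈ Set.Ioo (0 : ℝ) (1 / 8), x < (s - 9) / 32 → (17 + 2 * s) / 3 < g2 x := by
    rintro x ⟨h0, h1⟩ h
    unfold g2
    rw [mul_div_assoc', lt_div_iff₀ h0]
    nlinarith [mul_pos (sub_pos.2 h) (by linarith : 0 < 17 + 2 * s)]
  have em : max (g1 ((s - 9) / 32)) (g2 ((s - 9) / 32)) = (17 + 2 * s) / 3 := by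
    rw [e1, e2, max_self]
  refine ⟨?_, ht, em, e1.trans e2.symm, ?_⟩
  · apply IsLeast.csInf_eq
    refine ⟨⟨_, ht, em⟩, ?_⟩
    rintro _ ⟨x, hx, rfl⟩
    rcases lt_trichotomy x ((s - 9) / 32) with h | h | h
    · exact (k2 x hx h).le.trans (le_max_right _ _)
    · subst h
      exact em.ge
    · exact (k1 x hx h).le.trans (le_max_left _ _)
  · intro x hx he
    rcases lt_trichotomy x ((s - 9) / 32) with h | h | h
    · exact absurd he ((k2 x hx h).trans_le (le_max_right _ _)).ne'
    · exact h
    · exact absurd he ((k1 x hx h).trans_le (le_max_left _ _)).ne'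
end

section
/- Define on Δ^7 the six additional functions g_1(x) = σ(1−x_7)·σ(x_1), g_2(x) = σ(1−x_6)·σ(x_2), g_3(x) = σ(1−x_5)·σ(x_3), g_4(x) = σ(1−x_8)·σ(x_4), g_5(x) = σ(1−x_3)·σ(x_5), g_6(x) = σ(1−x_2)·σ(x_6), and let G†(x) = max(f_1(x),…,f_8(x), g_1(x),…,g_6(x)). Then inf_{x ∈ Δ^7} G†(x) = 5+3√2; moreover, at the point x̄ with x̄_i = (√2−1)/2 for i ∈ {1,4,7,8} and x̄_i = (3−2√2)/4 for i ∈ {2,3,5,6}, one has g_i(x̄) = 1 for every i ∈ {1,…,6}. -/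
noncomputable def gD (x : Fin 8 → ℝ) : Fin 6 → ℝ :=
  ![sigD (1 - x 6) * sigD (x 0),
    sigD (1 - x 5) * sigD (x 1),
    sigD (1 - x 4) * sigD (x 2),
    sigD (1 - x 7) * sigD (x 3),
    sigD (1 - x 2) * sigD (x 4),
    sigD (1 - x 1) * sigD (x 5)]

noncomputable def GD (x : Fin 8 → ℝ) : ℝ :=
  max (FD x) (Finset.univ.sup' Finset.univ_nonempty (gD x))

lemma sig_key {s y : ℝ} (hs : 0 < s) (hy : 0 < y)
    (h : sigD s * sigD y < 5 + 3 * Real.sqrt 2) :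
    1 - s < y * (1 - s + (5 + 3 * Real.sqrt 2) * s) := by
  unfold sigD at h
  rw [div_mul_div_comm, div_lt_iff₀ (by positivity)] at h
  nlinarith

lemma boundP {s y : ℝ} (hs : 0 < s) (hs1 : s < 1) (hy : 0 < y)
    (h : sigD s * sigD y < 5 + 3 * Real.sqrt 2) :
    (Real.sqrt 2 - 1) / 2 - (3 - Real.sqrt 2) / 2 * (s - (1 - Real.sqrt 2 / 2)) < y := by
  have h2 : Real.sqrt 2 * Real.sqrt 2 = 2 := Real.mul_self_sqrt (by norm_num)
  have h0 : 0 ≤ Real.sqrt 2 := Real.sqrt_nonneg 2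
  have hk := sig_key hs hy h
  generalize Real.sqrt 2 = r at *
  have hr : r < 3 := by nlinarith
  have hD : 0 < 1 - s + (5 + 3 * r) * s := by nlinarith [mul_nonneg h0 hs.le]
  refine lt_of_mul_lt_mul_right (lt_of_le_of_lt ?_ hk) hD.le
  have key : 1 - s - ((r - 1) / 2 - (3 - r) / 2 * (s - (1 - r / 2))) * (1 - s + (5 + 3 * r) * s)
      = (4 + 3 * r) * ((3 - r) / 2) * (s - (1 - r / 2)) ^ 2 := by
    have h3 : r ^ 2 = 2 := by rw [sq, h2]
    have h4 : r ^ 3 = 2 * r := by rw [pow_succ, h3]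
    have h5 : r ^ 4 = 4 := by rw [pow_succ, h4]; linarith
    ring_nf
    simp only [h3, h4, h5]
    ring
  have : 0 ≤ (4 + 3 * r) * ((3 - r) / 2) * (s - (1 - r / 2)) ^ 2 :=
    mul_nonneg (mul_nonneg (by linarith) (by linarith)) (sq_nonneg _)
  linarith

lemma boundQ {s y : ℝ} (hs : 0 < s) (hs1 : s < 1) (hy : 0 < y)
    (h : sigD s * sigD y < 5 + 3 * Real.sqrt 2) :
    (3 - 2 * Real.sqrt 2) / 4 + (3 - Real.sqrt 2) / 8 * (1 - s - (1 - Real.sqrt 2 / 2)) < y := by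
  have h2 : Real.sqrt 2 * Real.sqrt 2 = 2 := Real.mul_self_sqrt (by norm_num)
  have h0 : 0 ≤ Real.sqrt 2 := Real.sqrt_nonneg 2
  have hk := sig_key hs hy h
  generalize Real.sqrt 2 = r at *
  have hr : r < 3 := by nlinarith
  have hD : 0 < 1 - s + (5 + 3 * r) * s := by nlinarith [mul_nonneg h0 hs.le]
  refine lt_of_mul_lt_mul_right (lt_of_le_of_lt ?_ hk) hD.le
  have key : 1 - s - ((3 - 2 * r) / 4 + (3 - r) / 8 * (1 - s - (1 - r / 2)))
        * (1 - s + (5 + 3 * r) * s)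
      = (4 + 3 * r) * ((3 - r) / 8) * (1 - s - (1 - r / 2)) ^ 2 := by
    have h3 : r ^ 2 = 2 := by rw [sq, h2]
    have h4 : r ^ 3 = 2 * r := by rw [pow_succ, h3]
    have h5 : r ^ 4 = 4 := by rw [pow_succ, h4]; linarith
    ring_nf
    simp only [h3, h4, h5]
    ring
  have : 0 ≤ (4 + 3 * r) * ((3 - r) / 8) * (1 - s - (1 - r / 2)) ^ 2 :=
    mul_nonneg (mul_nonneg (by linarith) (by linarith)) (sq_nonneg _)
  linarith

lemma lower {x : Fin 8 → ℝ} (hx : x ∈ DeltaSeven) : 5 + 3 * Real.sqrt 2 ≤ GD x := by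
  by_contra hlt
  push Not at hlt
  have hF : FD x < 5 + 3 * Real.sqrt 2 := lt_of_le_of_lt (le_max_left _ _) hlt
  have hf : ∀ i, fD x i < 5 + 3 * Real.sqrt 2 := fun i =>
    (Finset.sup'_lt_iff _).1 hF i (Finset.mem_univ i)
  obtain ⟨hpos, hsum⟩ := hx
  simp only [Fin.sum_univ_eight] at hsum
  have p0 := hpos 0
  have p1 := hpos 1
  have p2 := hpos 2
  have p3 := hpos 3
  have p4 := hpos 4
  have p5 := hpos 5
  have p6 := hpos 6
  have p7 := hpos 7
  have b0 := boundP (by linarith) (by linarith) p0 (hf 0)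
  have b1 := boundQ (by linarith) (by linarith) p1 (hf 1)
  have b2 := boundQ (by linarith) (by linarith) p2 (hf 2)
  have b3 := boundP (by linarith) (by linarith) p3 (hf 3)
  have b4 := boundQ (by linarith) (by linarith) p4 (hf 4)
  have b5 := boundQ (by linarith) (by linarith) p5 (hf 5)
  have b6 := boundP (by linarith) (by linarith) p6 (hf 6)
  have b7 := boundP (by linarith) (by linarith) p7 (hf 7)
  have h2 : Real.sqrt 2 * Real.sqrt 2 = 2 := Real.mul_self_sqrt (by norm_num)
  have h0 : 0 ≤ Real.sqrt 2 := Real.sqrt_nonneg 2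
  clear hf hF hlt
  generalize Real.sqrt 2 = r at *
  have hr : r < 3 / 2 := by
    clear * - h2 h0
    nlinarith
  have hr1 : 1 < r := by
    clear * - h2 h0
    nlinarith
  obtain ⟨S, hS⟩ : ∃ S, S = x 0 + x 1 + x 2 + x 3 + x 4 + x 5 := ⟨_, rfl⟩
  obtain ⟨d, hd⟩ : ∃ d, d = S - (2 - r) := ⟨_, rfl⟩
  have e1 : (r - 1) - (3 - r) / 2 * d < 1 - S := by
    have : x 6 + x 7 = 1 - S := by linarith
    rw [← this, hd, hS]; linarith
  have hd1 : d < 0 := by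
    by_contra hn
    push Not at hn
    have := mul_nonneg hn (sub_nonneg.2 hr1.le)
    clear * - this e1 hd
    linarith
  have e67 : x 6 + x 7 = 1 - S := by linarith
  have e2 : (r - 1) - (3 - r) / 2 * d + (3 - 2 * r) + (3 - r) / 4 * d < S := by
    have t1 : 1 - (x 3 + x 4 + x 5 + x 6 + x 7) = x 0 + x 1 + x 2 := by linarith
    have t2 : 1 - (x 0 + x 1 + x 2 + x 6 + x 7) = x 3 + x 4 + x 5 := by linarith
    rw [t1] at b1 b5
    rw [t2] at b2 b4
    rw [hd, hS]; linarith
  have := mul_pos (neg_pos.2 hd1) (sub_pos.2 hr)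
  clear * - this e2 hd hd1
  linarith

lemma xbar_f (i : Fin 8) : fD xbar i = 5 + 3 * Real.sqrt 2 := by
  have h2 : Real.sqrt 2 * Real.sqrt 2 = 2 := Real.mul_self_sqrt (by norm_num)
  have h0 : 0 ≤ Real.sqrt 2 := Real.sqrt_nonneg 2
  have gen : ∀ s y : ℝ, 0 < s → 0 < y →
      (1 - s) * (1 - y) = (5 + 3 * Real.sqrt 2) * (s * y) →
      sigD s * sigD y = 5 + 3 * Real.sqrt 2 := by
    intro s y hs hy h
    unfold sigD
    rw [div_mul_div_comm, div_eq_iff (by positivity), h]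
  have hr : Real.sqrt 2 < 3 / 2 := by nlinarith
  have hr1 : 1 < Real.sqrt 2 := by nlinarith
  fin_cases i <;> simp [fD, xbar] <;>
    generalize Real.sqrt 2 = r at * <;>
    (refine gen _ _ (by linarith) (by linarith) ?_) <;>
    (have h3 : r ^ 2 = 2 := by rw [sq, h2]) <;>
    (have h4 : r ^ 3 = 2 * r := by rw [pow_succ, h3]) <;>
    ring_nf <;> simp only [h3, h4] <;> ring

lemma xbar_g (i : Fin 6) : gD xbar i = 1 := by
  have h2 : Real.sqrt 2 * Real.sqrt 2 = 2 := Real.mul_self_sqrt (by norm_num)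
  have h0 : 0 ≤ Real.sqrt 2 := Real.sqrt_nonneg 2
  have hr : Real.sqrt 2 < 3 / 2 := by nlinarith
  have hr1 : 1 < Real.sqrt 2 := by nlinarith
  have gen : ∀ y : ℝ, 0 < y → y < 1 → sigD (1 - y) * sigD y = 1 := by
    intro y hy hy1
    have : 1 - y ≠ 0 := by linarith
    unfold sigD
    field_simp
    ring
  fin_cases i <;> simp [gD, xbar] <;> exact gen _ (by linarith) (by linarith)

lemma xbar_mem : xbar ∈ DeltaSeven := by
  have h2 : Real.sqrt 2 * Real.sqrt 2 = 2 := Real.mul_self_sqrt (by norm_num)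
  have h0 : 0 ≤ Real.sqrt 2 := Real.sqrt_nonneg 2
  have hr : Real.sqrt 2 < 3 / 2 := by nlinarith
  have hr1 : 1 < Real.sqrt 2 := by nlinarith
  constructor
  · intro i
    fin_cases i <;> simp [xbar] <;> linarith
  · simp [Fin.sum_univ_eight, xbar]
    ring

theorem stmt19 :
    sInf (GD '' DeltaSeven) = 5 + 3 * Real.sqrt 2 ∧
    ∀ i : Fin 6, gD xbar i = 1 := by
  refine ⟨IsLeast.csInf_eq ⟨⟨xbar, xbar_mem, ?_⟩, ?_⟩, xbar_g⟩
  · refine le_antisymm (max_le ?_ ?_) (lower xbar_mem)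
    · exact Finset.sup'_le _ _ fun i _ => (xbar_f i).le
    · refine Finset.sup'_le _ _ fun i _ => ?_
      rw [xbar_g i]
      linarith [Real.sqrt_nonneg 2]
  · rintro _ ⟨x, hx, rfl⟩
    exact lower hx
end
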